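/- arXiv:2603.26119 — 2 statements merged into one kernel-verified Lean document; each statement's English description precedes it below -/
import Mathlib

section
/- Let m ≥ 1 and let π : ℝ^m×ℝ^m×ℝ^m → ℝ^m×ℝ^m be π(x₁,x₂,x₃) = (x₁+x₃, x₂+x₃). For every 𝐫 = (r₁,r₂,r₃) ∈ (0,∞)³ one has the set inclusions T(0, 𝐫/2) ⊆ π(B(0,r₁)×B(0,r₂)×B(0,r₃)) ⊆ T(0, 2𝐫), where 𝐫/2 = (r₁/2, r₂/2, r₃/2), 2𝐫 = (2r₁, 2r₂, 2r₃), and π(S) denotes the image of the set S under π. -/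
open MeasureTheory Set Metric ENNReal

noncomputable section

/-- The tube `T(0,𝐫) ⊆ ℝ^{2m}` associated with radii `𝐫 = (r₁,r₂,r₃)`. -/
def tube (m : ℕ) (r : ℝ × ℝ × ℝ) :
    Set (EuclideanSpace ℝ (Fin m) × EuclideanSpace ℝ (Fin m)) :=
  if r.2.2 ≤ min r.1 r.2.1 then
    {x | ‖x.1‖ < r.1 ∧ ‖x.2‖ < r.2.1}
  else if r.2.1 ≤ min r.1 r.2.2 then
    {x | ‖x.1 - x.2‖ < r.1 ∧ ‖x.2‖ < r.2.2}
  else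
    {x | ‖x.2 - x.1‖ < r.2.1 ∧ ‖x.1‖ < r.2.2}

/-- The projection `π(x₁,x₂,x₃) = (x₁+x₃, x₂+x₃)`. -/
def proj (m : ℕ) (x : EuclideanSpace ℝ (Fin m) × EuclideanSpace ℝ (Fin m) ×
    EuclideanSpace ℝ (Fin m)) : EuclideanSpace ℝ (Fin m) × EuclideanSpace ℝ (Fin m) :=
  (x.1 + x.2.2, x.2.1 + x.2.2)

/-- For every `𝐫 = (r₁,r₂,r₃) ∈ (0,∞)³`,
`T(0,𝐫/2) ⊆ π(B(0,r₁)×B(0,r₂)×B(0,r₃)) ⊆ T(0,2𝐫)`. -/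
theorem tube_proj_ball (m : ℕ) (hm : 1 ≤ m) (r₁ r₂ r₃ : ℝ)
    (h₁ : 0 < r₁) (h₂ : 0 < r₂) (h₃ : 0 < r₃) :
    tube m (r₁ / 2, r₂ / 2, r₃ / 2) ⊆
      proj m '' (ball (0 : EuclideanSpace ℝ (Fin m)) r₁ ×ˢ
        (ball (0 : EuclideanSpace ℝ (Fin m)) r₂ ×ˢ ball (0 : EuclideanSpace ℝ (Fin m)) r₃)) ∧
    proj m '' (ball (0 : EuclideanSpace ℝ (Fin m)) r₁ ×ˢ
        (ball (0 : EuclideanSpace ℝ (Fin m)) r₂ ×ˢ ball (0 : EuclideanSpace ℝ (Fin m)) r₃)) ⊆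
      tube m (2 * r₁, 2 * r₂, 2 * r₃) := by
  constructor
  · rintro ⟨x, y⟩ hxy
    unfold tube at hxy
    split_ifs at hxy <;> simp only [mem_ofPred_eq] at hxy
    · refine ⟨(x, y, 0), ?_, by simp [proj]⟩
      simp only [mem_prod, mem_ball_zero_iff, norm_zero]
      exact ⟨by linarith, by linarith, h₃⟩
    · refine ⟨(x - y, 0, y), ?_, by simp [proj]⟩
      simp only [mem_prod, mem_ball_zero_iff, norm_zero]
      exact ⟨by linarith, h₂, by linarith⟩
    · refine ⟨(0, y - x, x), ?_, by simp [proj]⟩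
      simp only [mem_prod, mem_ball_zero_iff, norm_zero]
      exact ⟨h₁, by linarith, by linarith⟩
  · rintro _ ⟨⟨x, y, z⟩, hxyz, rfl⟩
    simp only [mem_prod, mem_ball_zero_iff] at hxyz
    obtain ⟨hx, hy, hz⟩ := hxyz
    have hxz := norm_add_le x z
    have hyz := norm_add_le y z
    unfold tube proj
    split_ifs with h h' <;> simp only [mem_ofPred_eq, add_sub_add_right_eq_sub]
    · obtain ⟨h13, h23⟩ := le_min_iff.1 h
      constructor <;> linarith
    · obtain ⟨h21, h23⟩ := le_min_iff.1 h'
      have hxy := norm_sub_le x y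
      constructor <;> linarith
    · have hyx := norm_sub_le y x
      obtain ⟨h12, h13⟩ : r₁ ≤ r₂ ∧ r₁ ≤ r₃ := by grind
      constructor <;> linarith
end
end

section
/- Twisted covering lemma for tubes of type II. Let m ≥ 1 and κ > 0. There exists C > 0, depending only on m and κ, such that for every open set Ω ⊆ ℝ^{2m} with 0 < |Ω| < ∞ the following hold: (i) one can choose, for each R = I×_tJ ∈ m₂^{II}(Ω), a dyadic cube Î(R) of ℝ^m containing I such that ∑_{R = I×_tJ ∈ m₂^{II}(Ω)} |R| · (ℓ(I)/ℓ(Î(R)))^κ ≤ C|Ω|; and (ii) one can choose, for each R = I×_tJ ∈ m₁^{II}(Ω), a dyadic cube Ĵ(R) of ℝ^m containing J such that ∑_{R = I×_tJ ∈ m₁^{II}(Ω)} |R| · (ℓ(J)/ℓ(Ĵ(R)))^κ ≤ C|Ω|. -/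
open MeasureTheory Set Metric ENNReal

noncomputable section

abbrev Em (m : ℕ) := EuclideanSpace ℝ (Fin m)

/-- A dyadic cube `2^j(k + [0,1)^m)` of `ℝ^m`, recorded by its scale and corner. -/
structure DCube (m : ℕ) where
  j : ℤ
  k : Fin m → ℤ

/-- The underlying set of a dyadic cube. -/
def DCube.toSet {m : ℕ} (I : DCube m) : Set (Em m) :=
  {x | ∀ i, x i ∈ Ico ((2 : ℝ) ^ I.j * (I.k i : ℝ)) ((2 : ℝ) ^ I.j * ((I.k i : ℝ) + 1))}

/-- The sidelength `ℓ(I) = 2^j` of a dyadic cube. -/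
def DCube.len {m : ℕ} (I : DCube m) : ℝ := (2 : ℝ) ^ I.j

/-- The dyadic parent of a dyadic cube. -/
def DCube.parent {m : ℕ} (I : DCube m) : DCube m :=
  ⟨I.j + 1, fun i => Int.fdiv (I.k i) 2⟩

/-- The slant dyadic rectangle `I ×ₜ J = {(x₁,x₂) : x₁−x₂ ∈ I, x₂ ∈ J}`. -/
def slantII {m : ℕ} (I J : DCube m) : Set (Em m × Em m) :=
  {x | x.1 - x.2 ∈ I.toSet ∧ x.2 ∈ J.toSet}

/-- `m₂^{II}(Ω)`: type II slant dyadic rectangles `I ×ₜ J ⊆ Ω` with `I ×ₜ J′ ⊄ Ω`,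
where `J′` is the dyadic parent of `J`. -/
def m2II {m : ℕ} (Ω : Set (Em m × Em m)) : Set (DCube m × DCube m) :=
  {p | p.1.j ≤ p.2.j ∧ slantII p.1 p.2 ⊆ Ω ∧ ¬ slantII p.1 p.2.parent ⊆ Ω}

/-- `m₁^{II}(Ω)`: type II slant dyadic rectangles `I ×ₜ J ⊆ Ω` such that either
`ℓ(I′) > ℓ(J)` or `I′ ×ₜ J ⊄ Ω`, where `I′` is the dyadic parent of `I`. -/
def m1II {m : ℕ} (Ω : Set (Em m × Em m)) : Set (DCube m × DCube m) :=
  {p | p.1.j ≤ p.2.j ∧ slantII p.1 p.2 ⊆ Ω ∧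
    (p.2.j < p.1.j + 1 ∨ ¬ slantII p.1.parent p.2 ⊆ Ω)}

namespace DCube

variable {m : ℕ}

lemma len_pos (A : DCube m) : 0 < A.len := zpow_pos two_pos _

lemma mem_toSet_iff {A : DCube m} {x : Em m} :
    x ∈ A.toSet ↔ ∀ i, ⌊x i / 2 ^ A.j⌋ = A.k i := by
  have h : (0 : ℝ) < 2 ^ A.j := zpow_pos two_pos _
  refine forall_congr' fun i => ?_
  rw [Int.floor_eq_iff, mem_Ico, le_div_iff₀ h, div_lt_iff₀ h, mul_comm (A.k i : ℝ),
    mul_comm ((A.k i : ℝ) + 1)]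

lemma eq_of_mem {A B : DCube m} {x : Em m} (hA : x ∈ A.toSet) (hB : x ∈ B.toSet)
    (h : A.j = B.j) : A = B := by
  rw [mem_toSet_iff] at hA hB
  obtain ⟨j, k⟩ := A
  obtain ⟨j', k'⟩ := B
  obtain rfl : j = j' := h
  congr 1
  exact funext fun i => (hA i).symm.trans (hB i)

lemma toSet_subset_parent (A : DCube m) : A.toSet ⊆ A.parent.toSet := by
  intro x hx
  rw [mem_toSet_iff] at hx ⊢
  intro i
  have h : x i / 2 ^ (A.j + 1) = x i / 2 ^ A.j / (2 : ℕ) := by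
    rw [zpow_add₀ two_ne_zero, zpow_one, div_div, Nat.cast_ofNat]
  simp only [parent]
  rw [h, Int.floor_div_natCast, hx i, Int.fdiv_eq_ediv_of_nonneg _ zero_le_two, Nat.cast_ofNat]

lemma toSet_subset_iterate_parent (A : DCube m) (n : ℕ) : A.toSet ⊆ (parent^[n] A).toSet := by
  induction n with
  | zero => rfl
  | succ n ih =>
    rw [Function.iterate_succ_apply']
    exact ih.trans (toSet_subset_parent _)

lemma j_iterate_parent (A : DCube m) (n : ℕ) : (parent^[n] A).j = A.j + n := by
  induction n with
  | zero => simp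
  | succ n ih =>
    rw [Function.iterate_succ_apply', parent, ih]
    push_cast
    ring

lemma len_iterate_parent (A : DCube m) (n : ℕ) : (parent^[n] A).len = 2 ^ n * A.len := by
  rw [len, j_iterate_parent, zpow_add₀ two_ne_zero, zpow_natCast, mul_comm, len]

lemma exists_iterate_parent_eq {A B : DCube m} {x : Em m} (hA : x ∈ A.toSet) (hB : x ∈ B.toSet)
    (h : A.j ≤ B.j) : ∃ n : ℕ, parent^[n] A = B := by
  refine ⟨(B.j - A.j).toNat, eq_of_mem (toSet_subset_iterate_parent _ _ hA) hB ?_⟩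
  rw [j_iterate_parent]
  omega

/-- Two distinct intersecting dyadic cubes are strictly nested. -/
lemma parent_subset_or_parent_subset {A B : DCube m} {x : Em m} (hA : x ∈ A.toSet)
    (hB : x ∈ B.toSet) (hne : A ≠ B) :
    (A.j < B.j ∧ A.parent.toSet ⊆ B.toSet) ∨ (B.j < A.j ∧ B.parent.toSet ⊆ A.toSet) := by
  wlog h : A.j ≤ B.j generalizing A B
  · exact (this hB hA hne.symm (le_of_not_ge h)).symm
  have hlt : A.j < B.j := lt_of_le_of_ne h fun h => hne (eq_of_mem hA hB h)
  obtain ⟨n, hn⟩ := exists_iterate_parent_eq (A.toSet_subset_parent hA) hB hlt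
  exact Or.inl ⟨hlt, hn ▸ toSet_subset_iterate_parent _ n⟩

instance : Countable (DCube m) :=
  Function.Injective.countable (f := fun A : DCube m => (A.j, A.k)) fun A B h => by
    cases A; cases B; simpa using h

lemma toSet_eq_preimage (A : DCube m) :
    A.toSet = (WithLp.ofLp : Em m → Fin m → ℝ) ⁻¹'
      (univ.pi fun i => Ico (2 ^ A.j * (A.k i : ℝ)) (2 ^ A.j * ((A.k i : ℝ) + 1))) := by
  ext x
  simp [toSet]

lemma measurableSet_toSet (A : DCube m) : MeasurableSet A.toSet := by
  rw [toSet_eq_preimage]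
  exact (PiLp.volume_preserving_ofLp (Fin m)).measurable
    (MeasurableSet.univ_pi fun _ => measurableSet_Ico)

lemma volume_toSet (A : DCube m) : volume A.toSet = ENNReal.ofReal A.len ^ m := by
  rw [toSet_eq_preimage, (PiLp.volume_preserving_ofLp (Fin m)).measure_preimage
    (MeasurableSet.univ_pi fun _ => measurableSet_Ico).nullMeasurableSet, Real.volume_pi_Ico]
  have h : ∀ i, (2 : ℝ) ^ A.j * ((A.k i : ℝ) + 1) - 2 ^ A.j * (A.k i : ℝ) = A.len := fun i => by
    rw [len]; ring
  simp [h]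

lemma volume_toSet_ne_zero (A : DCube m) : volume A.toSet ≠ 0 := by
  rw [volume_toSet]
  exact pow_ne_zero _ (ENNReal.ofReal_pos.2 A.len_pos).ne'

lemma volume_toSet_ne_top (A : DCube m) : volume A.toSet ≠ ⊤ := by
  rw [volume_toSet]
  exact ENNReal.pow_ne_top ENNReal.ofReal_ne_top

lemma two_pow_mul_volume_le (hm : 1 ≤ m) (A : DCube m) (n : ℕ) :
    2 ^ n * volume A.toSet ≤ volume (parent^[n] A).toSet := by
  rw [volume_toSet, volume_toSet, len_iterate_parent, ENNReal.ofReal_mul (by positivity), mul_pow]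
  refine mul_le_mul' ?_ le_rfl
  rw [ENNReal.ofReal_pow zero_le_two, ENNReal.ofReal_ofNat]
  have h : (1 : ℝ≥0∞) ≤ 2 := one_le_two
  exact le_self_pow₀ (one_le_pow₀ h) (Nat.one_le_iff_ne_zero.1 hm)

/-- The union of all dyadic cubes `B` with `A × B ⊆ U`. -/
def dyadicSection (U : Set (Em m × Em m)) (A : DCube m) : Set (Em m) :=
  ⋃ B ∈ {B : DCube m | A.toSet ×ˢ B.toSet ⊆ U}, B.toSet

lemma measurableSet_dyadicSection (U : Set (Em m × Em m)) (A : DCube m) :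
    MeasurableSet (dyadicSection U A) :=
  MeasurableSet.biUnion (to_countable _) fun B _ => B.measurableSet_toSet

lemma prod_dyadicSection_subset (U : Set (Em m × Em m)) (A : DCube m) :
    A.toSet ×ˢ dyadicSection U A ⊆ U := by
  rintro ⟨y, z⟩ ⟨hy, hz⟩
  obtain ⟨B, hB, hzB⟩ := mem_iUnion₂.1 hz
  exact hB ⟨hy, hzB⟩

lemma subset_dyadicSection {U : Set (Em m × Em m)} {A B : DCube m}
    (h : A.toSet ×ˢ B.toSet ⊆ U) : B.toSet ⊆ dyadicSection U A :=
  subset_biUnion_of_mem (u := fun B : DCube m => B.toSet) h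

lemma dyadicSection_anti (U : Set (Em m × Em m)) {A A' : DCube m} (h : A.toSet ⊆ A'.toSet) :
    dyadicSection U A' ⊆ dyadicSection U A :=
  biUnion_subset_biUnion_left fun _ hB => (prod_mono_left h).trans hB

lemma antitone_dyadicSection_iterate_parent (U : Set (Em m × Em m)) (A : DCube m) :
    Antitone fun n => dyadicSection U (parent^[n] A) :=
  antitone_nat_of_succ_le fun n => dyadicSection_anti U <| by
    rw [Function.iterate_succ_apply']
    exact toSet_subset_parent _

lemma exists_two_mul_volume_inter_le (hm : 1 ≤ m) {U : Set (Em m × Em m)} (hU : volume U ≠ ⊤)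
    (A B : DCube m) :
    ∃ n : ℕ, 2 * volume (B.toSet ∩ dyadicSection U (parent^[n + 1] A)) ≤ volume B.toSet := by
  by_contra! h
  have hAB : volume A.toSet * volume B.toSet ≠ 0 :=
    mul_ne_zero A.volume_toSet_ne_zero B.volume_toSet_ne_zero
  have key (n : ℕ) : (n : ℝ≥0∞) * (volume A.toSet * volume B.toSet) ≤ volume U := by
    have h1 : 2 ^ n * 2 * (volume A.toSet * volume B.toSet) ≤ 2 * volume U := by
      calc 2 ^ n * 2 * (volume A.toSet * volume B.toSet)
          = (2 ^ (n + 1) * volume A.toSet) * volume B.toSet := by ring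
        _ ≤ volume (parent^[n + 1] A).toSet *
              (2 * volume (B.toSet ∩ dyadicSection U (parent^[n + 1] A))) :=
            mul_le_mul' (two_pow_mul_volume_le hm A _) (h n).le
        _ = 2 * volume ((parent^[n + 1] A).toSet ×ˢ
              (B.toSet ∩ dyadicSection U (parent^[n + 1] A))) := by
            rw [Measure.volume_eq_prod, Measure.prod_prod]; ring
        _ ≤ 2 * volume U := by
            gcongr
            exact (prod_mono_right inter_subset_right).trans (prod_dyadicSection_subset U _)
    have h2 : 2 * (2 ^ n * (volume A.toSet * volume B.toSet)) ≤ 2 * volume U := by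
      convert h1 using 1; ring
    refine le_trans ?_ ((ENNReal.mul_le_mul_iff_right two_ne_zero ENNReal.ofNat_ne_top).1 h2)
    gcongr
    exact_mod_cast Nat.lt_two_pow_self.le
  obtain ⟨n, hn⟩ := ENNReal.exists_nat_mul_gt hAB hU
  exact (key n).not_gt hn

end DCube

section

open DCube

variable {m : ℕ}

/-- Journé's covering lemma for families of products of dyadic cubes `a p × b p` in which the
rectangles with a common first factor are disjoint. -/
lemma exists_enlargement_tsum_le (hm : 1 ≤ m) {κ : ℝ} (hκ : 0 < κ) {α : Type*} [Countable α]
    {U : Set (Em m × Em m)} (hU : volume U ≠ ⊤) (S : Set α) (a b : α → DCube m)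
    (hab : ∀ p ∈ S, (a p).toSet ×ˢ (b p).toSet ⊆ U)
    (hdisj : ∀ p ∈ S, ∀ q ∈ S, p ≠ q → a p = a q → Disjoint (b p).toSet (b q).toSet) :
    ∃ hat : α → DCube m, (∀ p ∈ S, (a p).toSet ⊆ (hat p).toSet) ∧
      ∑' p : S, volume (a p.val).toSet * volume (b p.val).toSet *
          ENNReal.ofReal (((a p.val).len / (hat p.val).len) ^ κ) ≤
        ENNReal.ofReal (2 / (1 - 2 ^ (-κ))) * volume U := by
  choose n hn using fun p => exists_two_mul_volume_inter_le hm hU (a p) (b p)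
  let E (p : α) (k : ℕ) : Set (Em m) := dyadicSection U (parent^[k] (a p))
  let D (k : ℕ) (p : α) : Set (Em m × Em m) :=
    (a p).toSet ×ˢ ((b p).toSet ∩ (E p k \ E p (k + 1)))
  have hr0 : (0 : ℝ) < 2 ^ (-κ) := Real.rpow_pos_of_pos two_pos _
  have hr1 : (2 : ℝ) ^ (-κ) < 1 := Real.rpow_lt_one_of_one_lt_of_neg one_lt_two (neg_lt_zero.2 hκ)
  set r : ℝ≥0∞ := ENNReal.ofReal (2 ^ (-κ)) with hr
  have hr1' : r ≤ 1 := ENNReal.ofReal_le_one.2 hr1.le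
  have hEm (p : α) (k : ℕ) : MeasurableSet (E p k) := measurableSet_dyadicSection U _
  have hDm (k : ℕ) (p : α) : MeasurableSet (D k p) :=
    (a p).measurableSet_toSet.prod
      ((b p).measurableSet_toSet.inter ((hEm p k).diff (hEm p (k + 1))))
  have hDU (k : ℕ) (p : α) : D k p ⊆ U := by
    rintro ⟨y, z⟩ ⟨hy, -, hz, -⟩
    exact prod_dyadicSection_subset U _ ⟨toSet_subset_iterate_parent _ k hy, hz⟩
  have hDdisj (k : ℕ) : Pairwise (Function.onFun Disjoint fun p : S => D k p) := by
    rintro ⟨p, hp⟩ ⟨q, hq⟩ hpq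
    refine Set.disjoint_left.2 ?_
    rintro ⟨y, z⟩ ⟨hyp, hzp, hzp'⟩ ⟨hyq, hzq, hzq'⟩
    have aux {p q : α} (hyp : y ∈ (a p).toSet) (hyq : y ∈ (a q).toSet)
        (hzp : z ∉ E p (k + 1)) (hzq : z ∈ E q k) (hle : (a p).j ≤ (a q).j) : a p = a q := by
      obtain ⟨l, hl⟩ := exists_iterate_parent_eq hyp hyq hle
      rcases l.eq_zero_or_pos with rfl | hl0
      · exact hl
      · refine absurd (antitone_dyadicSection_iterate_parent U (a p)
          (show k + 1 ≤ k + l by omega) ?_) hzp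
        simpa only [Function.iterate_add_apply, hl] using hzq
    have heq : a p = a q := by
      rcases le_total (a p).j (a q).j with h | h
      · exact aux hyp hyq hzp'.2 hzq'.1 h
      · exact (aux hyq hyp hzq'.2 hzp'.1 h).symm
    exact Set.disjoint_left.1 (hdisj p hp q hq (fun h => hpq (Subtype.ext h)) heq) hzp hzq
  have hsum (k : ℕ) : ∑' p : S, volume (D k p) ≤ volume U :=
    (measure_iUnion (hDdisj k) fun p : S => hDm k p).symm.trans_le
      (measure_mono (iUnion_subset fun p : S => hDU k p))
  have hcover (p : α) (hp : p ∈ S) :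
      (b p).toSet \ E p (n p + 1) ⊆
        ⋃ k ∈ Finset.range (n p + 1), (b p).toSet ∩ (E p k \ E p (k + 1)) := by
    rintro z ⟨hzb, hzE⟩
    have hex : ∃ k, z ∉ E p (k + 1) := ⟨_, hzE⟩
    classical
    refine mem_iUnion₂.2 ⟨Nat.find hex, Finset.mem_range_succ_iff.2 (Nat.find_min' hex hzE), hzb,
      ?_, Nat.find_spec hex⟩
    rcases h : Nat.find hex with _ | l
    · exact subset_dyadicSection (hab p hp) hzb
    · exact not_not.1 (Nat.find_min hex (h ▸ l.lt_succ_self))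
  have hterm (p : S) : volume (a p.val).toSet * volume (b p.val).toSet * r ^ n p ≤
      2 * ∑' k : ℕ, r ^ k * volume (D k p) := by
    obtain ⟨p, hp⟩ := p
    have hhalf : volume (b p).toSet ≤ 2 * volume ((b p).toSet \ E p (n p + 1)) := by
      have h1 := measure_inter_add_sdiff (μ := volume) (b p).toSet (hEm p (n p + 1))
      have h2 : volume (b p).toSet + volume (b p).toSet ≤
          volume (b p).toSet + 2 * volume ((b p).toSet \ E p (n p + 1)) := by
        calc volume (b p).toSet + volume (b p).toSet
            = 2 * volume ((b p).toSet ∩ E p (n p + 1)) +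
                2 * volume ((b p).toSet \ E p (n p + 1)) := by
              rw [← mul_add, h1, two_mul]
          _ ≤ _ := by gcongr; exact hn p
      exact (ENNReal.add_le_add_iff_left (b p).volume_toSet_ne_top).1 h2
    calc volume (a p).toSet * volume (b p).toSet * r ^ n p
        ≤ volume (a p).toSet * (2 * ∑ k ∈ Finset.range (n p + 1),
            volume ((b p).toSet ∩ (E p k \ E p (k + 1)))) * r ^ n p := by
          gcongr
          refine hhalf.trans ?_
          gcongr
          exact (measure_mono (hcover p hp)).trans (measure_biUnion_finset_le _ _)
      _ = 2 * ∑ k ∈ Finset.range (n p + 1), r ^ n p * volume (D k p) := by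
          simp only [D, Measure.volume_eq_prod, Measure.prod_prod, Finset.mul_sum, Finset.sum_mul]
          exact Finset.sum_congr rfl fun k _ => by ring
      _ ≤ 2 * ∑ k ∈ Finset.range (n p + 1), r ^ k * volume (D k p) := by
          gcongr 2 * ∑ k ∈ _, ?_ * _ with k hk
          exact pow_le_pow_right_of_le_one' hr1' (Finset.mem_range_succ_iff.1 hk)
      _ ≤ 2 * ∑' k : ℕ, r ^ k * volume (D k p) := by
          gcongr
          exact ENNReal.sum_le_tsum _
  refine ⟨fun p => parent^[n p] (a p), fun p _ => toSet_subset_iterate_parent _ _, ?_⟩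
  have hratio (p : α) :
      ENNReal.ofReal (((a p).len / (parent^[n p] (a p)).len) ^ κ) = r ^ n p := by
    rw [hr, ← ENNReal.ofReal_pow hr0.le, len_iterate_parent,
      div_mul_cancel_right₀ (a p).len_pos.ne', Real.inv_rpow (by positivity),
      ← Real.rpow_natCast 2, ← Real.rpow_mul zero_le_two, ← Real.rpow_mul_natCast zero_le_two,
      ← Real.rpow_neg zero_le_two]
    congr 2
    ring
  calc ∑' p : S, volume (a p.val).toSet * volume (b p.val).toSet *
          ENNReal.ofReal (((a p.val).len / (parent^[n p.val] (a p.val)).len) ^ κ)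
      ≤ ∑' p : S, 2 * ∑' k : ℕ, r ^ k * volume (D k p) :=
        ENNReal.tsum_le_tsum fun p => by rw [hratio]; exact hterm p
    _ = 2 * ∑' k : ℕ, r ^ k * ∑' p : S, volume (D k p) := by
        rw [ENNReal.tsum_mul_left, ENNReal.tsum_comm]
        simp only [ENNReal.tsum_mul_left]
    _ ≤ 2 * ∑' k : ℕ, r ^ k * volume U := by
        gcongr 2 * ?_
        exact ENNReal.tsum_le_tsum fun k => by gcongr; exact hsum k
    _ = ENNReal.ofReal (2 / (1 - 2 ^ (-κ))) * volume U := by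
        rw [ENNReal.tsum_mul_right, ENNReal.tsum_geometric, ENNReal.ofReal_div_of_pos (by linarith),
          ENNReal.ofReal_sub _ hr0.le, ENNReal.ofReal_one, ENNReal.ofReal_ofNat, ← mul_assoc,
          div_eq_mul_inv]

lemma slantII_mono {I I' J J' : DCube m} (hI : I.toSet ⊆ I'.toSet) (hJ : J.toSet ⊆ J'.toSet) :
    slantII I J ⊆ slantII I' J' :=
  fun _ hx => ⟨hI hx.1, hJ hx.2⟩

lemma volume_slantII (I J : DCube m) :
    volume (slantII I J) = volume I.toSet * volume J.toSet := by
  rw [← Measure.prod_prod, ← (measurePreserving_sub_prod (volume : Measure (Em m))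
    volume).measure_preimage (I.measurableSet_toSet.prod J.measurableSet_toSet).nullMeasurableSet]
  rfl

lemma disjoint_of_mem_m2II {Ω : Set (Em m × Em m)} {I J J' : DCube m} (h : (I, J) ∈ m2II Ω)
    (h' : (I, J') ∈ m2II Ω) (hne : J ≠ J') : Disjoint J.toSet J'.toSet := by
  refine Set.disjoint_left.2 fun x hx hx' => ?_
  rcases parent_subset_or_parent_subset hx hx' hne with ⟨-, hs⟩ | ⟨-, hs⟩
  · exact h.2.2 ((slantII_mono subset_rfl hs).trans h'.2.1)
  · exact h'.2.2 ((slantII_mono subset_rfl hs).trans h.2.1)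

lemma disjoint_of_mem_m1II {Ω : Set (Em m × Em m)} {I I' J : DCube m} (h : (I, J) ∈ m1II Ω)
    (h' : (I', J) ∈ m1II Ω) (hne : I ≠ I') : Disjoint I.toSet I'.toSet := by
  refine Set.disjoint_left.2 fun x hx hx' => ?_
  obtain ⟨hj, hs, hmax⟩ := h
  obtain ⟨hj', hs', hmax'⟩ := h'
  dsimp only at *
  rcases parent_subset_or_parent_subset hx hx' hne with ⟨hlt, hsub⟩ | ⟨hlt, hsub⟩
  · exact hmax.elim (fun _ => by omega) fun hn => hn ((slantII_mono hsub subset_rfl).trans hs')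
  · exact hmax'.elim (fun _ => by omega) fun hn => hn ((slantII_mono hsub subset_rfl).trans hs)

end

/-- **Twisted covering lemma, type II.** For `m ≥ 1` and `κ > 0` there
is `C > 0`, depending only on `m` and `κ`, such that for every open `Ω ⊆ ℝ^{2m}` of
finite positive measure one may choose enlargements `Î ⊇ I` (resp. `Ĵ ⊇ J`) of the
maximal type II tubes in `m₂^{II}(Ω)` (resp. `m₁^{II}(Ω)`) with
`∑ |R| (ℓ(I)/ℓ(Î))^κ ≤ C|Ω|` (resp. `∑ |R| (ℓ(J)/ℓ(Ĵ))^κ ≤ C|Ω|`). -/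
theorem twisted_covering_II (m : ℕ) (hm : 1 ≤ m) (κ : ℝ) (hκ : 0 < κ) :
    ∃ C : ℝ, 0 < C ∧
      ∀ Ω : Set (Em m × Em m), IsOpen Ω → 0 < volume Ω → volume Ω < ⊤ →
        (∃ Ihat : DCube m × DCube m → DCube m,
          (∀ p ∈ m2II Ω, p.1.toSet ⊆ (Ihat p).toSet) ∧
          (∑' p : m2II Ω, volume (slantII p.val.1 p.val.2) *
              ENNReal.ofReal ((p.val.1.len / (Ihat p.val).len) ^ κ)) ≤
            ENNReal.ofReal C * volume Ω) ∧
        (∃ Jhat : DCube m × DCube m → DCube m,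
          (∀ p ∈ m1II Ω, p.2.toSet ⊆ (Jhat p).toSet) ∧
          (∑' p : m1II Ω, volume (slantII p.val.1 p.val.2) *
              ENNReal.ofReal ((p.val.2.len / (Jhat p.val).len) ^ κ)) ≤
            ENNReal.ofReal C * volume Ω) := by
  have hr1 : (2 : ℝ) ^ (-κ) < 1 := Real.rpow_lt_one_of_one_lt_of_neg one_lt_two (neg_lt_zero.2 hκ)
  refine ⟨2 / (1 - 2 ^ (-κ)), div_pos two_pos (by linarith), fun Ω hΩ _ hfin => ?_⟩
  have hshear : MeasurePreserving (fun q : Em m × Em m => (q.1 + q.2, q.2)) volume volume :=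
    measurePreserving_add_prod volume volume
  have hshear' : MeasurePreserving (fun q : Em m × Em m => (q.2 + q.1, q.1)) volume volume :=
    hshear.comp Measure.measurePreserving_swap
  have hvol := hshear.measure_preimage hΩ.measurableSet.nullMeasurableSet
  have hvol' := hshear'.measure_preimage hΩ.measurableSet.nullMeasurableSet
  constructor
  · obtain ⟨hat, hsub, hle⟩ := exists_enlargement_tsum_le hm hκ (hvol.trans_ne hfin.ne) (m2II Ω)
      Prod.fst Prod.snd
      (fun p hp q hq => hp.2.1 ⟨by simpa using hq.1, hq.2⟩)
      (by
        rintro ⟨I, J⟩ hp ⟨I', J'⟩ hq hne heq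
        obtain rfl : I = I' := heq
        exact disjoint_of_mem_m2II hp hq fun h => hne (Prod.ext rfl h))
    refine ⟨hat, hsub, ?_⟩
    rw [hvol] at hle
    simpa only [volume_slantII] using hle
  · obtain ⟨hat, hsub, hle⟩ := exists_enlargement_tsum_le hm hκ (hvol'.trans_ne hfin.ne) (m1II Ω)
      Prod.snd Prod.fst
      (fun p hp q hq => hp.2.1 ⟨by simpa using hq.2, hq.1⟩)
      (by
        rintro ⟨I, J⟩ hp ⟨I', J'⟩ hq hne heq
        obtain rfl : J = J' := heq
        exact disjoint_of_mem_m1II hp hq fun h => hne (Prod.ext h rfl))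
    refine ⟨hat, hsub, ?_⟩
    rw [hvol'] at hle
    simpa only [volume_slantII, mul_comm (volume (DCube.toSet (Prod.fst _)))] using hle
end
end
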